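/- arXiv:2107.14713 — 2 statements merged into one kernel-verified Lean document; each statement's English description precedes it below -/
import Mathlib

section
/- A crown-free linear 3-graph contains no edge {a,b,c} with d(a) ≥ 6, d(b) ≥ 4 and d(c) ≥ 2; that is, no edge e of a crown-free linear 3-graph satisfies D(e) ≥ (6,4,2). -/
/-- `E` is (the edge set of) a linear 3-graph: every edge has 3 vertices and
any two distinct edges intersect in at most one vertex. -/
def LinearTripleSystem {V : Type*} [DecidableEq V] (E : Finset (Finset V)) : Prop :=
  (∀ e ∈ E, e.card = 3) ∧ ∀ e ∈ E, ∀ f ∈ E, e ≠ f → (e ∩ f).card ≤ 1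

/-- `E` contains a crown: three pairwise disjoint edges (jewels) together with a
base edge intersecting all three jewels. -/
def HasCrown {V : Type*} [DecidableEq V] (E : Finset (Finset V)) : Prop :=
  ∃ base ∈ E, ∃ j1 ∈ E, ∃ j2 ∈ E, ∃ j3 ∈ E,
    Disjoint j1 j2 ∧ Disjoint j1 j3 ∧ Disjoint j2 j3 ∧
    (base ∩ j1).Nonempty ∧ (base ∩ j2).Nonempty ∧ (base ∩ j3).Nonempty

/-- The degree of a vertex: the number of edges containing it. -/
def degree {V : Type*} [DecidableEq V] (E : Finset (Finset V)) (v : V) : ℕ :=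
  (E.filter (fun e => v ∈ e)).card

/-- Two edges of a linear 3-graph sharing two distinct vertices coincide. -/
theorem LinearTripleSystem.eq_of_mem {V : Type*} [DecidableEq V] {E : Finset (Finset V)}
    (hlin : LinearTripleSystem E) {e f : Finset V} (he : e ∈ E) (hf : f ∈ E) {x y : V}
    (hxy : x ≠ y) (hxe : x ∈ e) (hye : y ∈ e) (hxf : x ∈ f) (hyf : y ∈ f) : e = f := by
  by_contra hne
  exact hxy (Finset.card_le_one.mp (hlin.2 e he f hf hne) x (Finset.mem_inter.mpr ⟨hxe, hxf⟩)
    y (Finset.mem_inter.mpr ⟨hye, hyf⟩))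

/-- In a linear 3-graph, a vertex outside `S` whose degree exceeds the size of `S` lies on an
edge disjoint from `S`. -/
theorem LinearTripleSystem.exists_mem_disjoint {V : Type*} [DecidableEq V]
    {E : Finset (Finset V)} (hlin : LinearTripleSystem E) {v : V} {S : Finset V} (hv : v ∉ S)
    (hS : S.card < degree E v) : ∃ g ∈ E, v ∈ g ∧ Disjoint g S := by
  by_contra! h
  have hmeet : ∀ g ∈ E.filter (fun e => v ∈ e), ∃ x ∈ S, x ∈ g := by
    intro g hg
    obtain ⟨hgE, hvg⟩ := Finset.mem_filter.mp hg
    obtain ⟨x, hxg, hxS⟩ := Finset.not_disjoint_iff.mp (h g hgE hvg)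
    exact ⟨x, hxS, hxg⟩
  refine hS.not_ge (Finset.card_le_card_of_forall_subsingleton (fun g x => x ∈ g) hmeet ?_)
  rintro x hx g ⟨hg, hxg⟩ g' ⟨hg', hxg'⟩
  obtain ⟨hgE, hvg⟩ := Finset.mem_filter.mp hg
  obtain ⟨hgE', hvg'⟩ := Finset.mem_filter.mp hg'
  exact hlin.eq_of_mem hgE hgE' (ne_of_mem_of_not_mem hx hv) hxg hvg hxg' hvg'

/-- A crown-free linear 3-graph contains no edge `{a,b,c}` with `d(a) ≥ 6`,
`d(b) ≥ 4` and `d(c) ≥ 2`; i.e. no edge `e` with `D(e) ≥ (6,4,2)`. -/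
theorem crown_free_no_642 {V : Type*} [DecidableEq V] (E : Finset (Finset V))
    (hlin : LinearTripleSystem E) (hcf : ¬ HasCrown E) :
    ¬ ∃ a b c : V, a ≠ b ∧ a ≠ c ∧ b ≠ c ∧ ({a, b, c} : Finset V) ∈ E ∧
        6 ≤ degree E a ∧ 4 ≤ degree E b ∧ 2 ≤ degree E c := by
  rintro ⟨a, b, c, hab, hac, hbc, he, ha, hb, hc⟩
  obtain ⟨f, hf, hcf', hfa⟩ := hlin.exists_mem_disjoint (v := c) (S := {a})
    (by simpa using hac.symm) (by simpa [Nat.lt_iff_add_one_le] using hc)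
  have haf : a ∉ f := Finset.disjoint_singleton_right.mp hfa
  have hbf : b ∉ f := fun h => haf <| by
    rw [hlin.eq_of_mem hf he hbc h hcf' (by simp) (by simp)]
    simp
  have hf3 := hlin.1 f hf
  obtain ⟨g, hg, hbg, hgf⟩ := hlin.exists_mem_disjoint hbf (by lia)
  have hcg : c ∉ g := Finset.disjoint_right.mp hgf hcf'
  have hag : a ∉ g := fun h => hcg <| by
    rw [hlin.eq_of_mem hg he hab h hbg (by simp) (by simp)]
    simp
  have hg3 := hlin.1 g hg
  have hcard : (f ∪ g.erase b).card < 6 := by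
    have h₁ := Finset.card_union_le f (g.erase b)
    have h₂ := Finset.card_erase_of_mem hbg
    lia
  obtain ⟨j, hj, haj, hjS⟩ := hlin.exists_mem_disjoint (v := a) (S := f ∪ g.erase b)
    (by simp [haf, hag]) (by lia)
  obtain ⟨hjf, hjg'⟩ := Finset.disjoint_union_right.mp hjS
  have hbj : b ∉ j := fun h => Finset.disjoint_right.mp hjf hcf' <| by
    rw [hlin.eq_of_mem hj he hab haj h (by simp) (by simp)]
    simp
  have hjg : Disjoint j g := by
    rw [← Finset.insert_erase hbg]
    exact Finset.disjoint_insert_right.mpr ⟨hbj, hjg'⟩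
  exact hcf ⟨_, he, j, hj, g, hg, f, hf, hjg, hjf, hgf,
    ⟨a, by simp [haj]⟩, ⟨b, by simp [hbg]⟩, ⟨c, by simp [hcf']⟩⟩
end

section
/- Let H be a crown-free linear 3-graph and let e = {a,b,c} be an edge of H with d(a) = d(b) = d(c) = 4. For x ∈ {a,b,c}, let M_x denote the union of the sets f \ {x} over all edges f ≠ e of H containing x. Then |M_a ∩ M_b| ≤ 5. -/
/-- `linkMatching E e x` is `M_x`: the union of the sets `f \ {x}` over all
edges `f ≠ e` of `E` containing `x`. -/
def linkMatching {V : Type*} [DecidableEq V] (E : Finset (Finset V))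
    (e : Finset V) (x : V) : Finset V :=
  (E.filter (fun f => f ≠ e ∧ x ∈ f)).biUnion (fun f => f \ {x})

section

variable {V : Type*} [DecidableEq V]

/-- `u` and `v` are the two further vertices of an edge through `x`, and both lie outside `e`. -/
def LinkPair (E : Finset (Finset V)) (e : Finset V) (x u v : V) : Prop :=
  u ∉ e ∧ v ∉ e ∧ u ≠ v ∧ ({x, u, v} : Finset V) ∈ E

theorem LinearTripleSystem.eq_of_mem_mem {E : Finset (Finset V)} (hlin : LinearTripleSystem E)
    {f g : Finset V} (hf : f ∈ E) (hg : g ∈ E) {u v : V} (huv : u ≠ v)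
    (huf : u ∈ f) (hvf : v ∈ f) (hug : u ∈ g) (hvg : v ∈ g) : f = g := by
  by_contra hne
  have hle := hlin.2 f hf g hg hne
  exact huv (Finset.card_le_one.mp hle u (by simp [huf, hug]) v (by simp [hvf, hvg]))

theorem LinkPair.symm {E : Finset (Finset V)} {e : Finset V} {x u v : V}
    (h : LinkPair E e x u v) : LinkPair E e x v u :=
  ⟨h.2.1, h.1, h.2.2.1.symm, by rw [Finset.pair_comm]; exact h.2.2.2⟩

theorem LinkPair.right_unique {E : Finset (Finset V)} (hlin : LinearTripleSystem E)
    {e : Finset V} {x u v w : V} (hx : x ∈ e)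
    (hv : LinkPair E e x u v) (hw : LinkPair E e x u w) : v = w := by
  obtain ⟨hu, hv', huv, hvE⟩ := hv
  obtain ⟨-, hw', huw, hwE⟩ := hw
  have hxu : x ≠ u := by rintro rfl; exact hu hx
  have hxv : x ≠ v := by rintro rfl; exact hv' hx
  have heq := hlin.eq_of_mem_mem hvE hwE hxu (by simp) (by simp) (by simp) (by simp)
  have hmem : v ∈ ({x, u, w} : Finset V) := heq ▸ (by simp)
  simp only [Finset.mem_insert, Finset.mem_singleton] at hmem
  grind

theorem LinkPair.base_unique {E : Finset (Finset V)} (hlin : LinearTripleSystem E)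
    {e : Finset V} {x y u v : V} (hx : x ∈ e)
    (h : LinkPair E e x u v) (h' : LinkPair E e y u v) : x = y := by
  have heq := hlin.eq_of_mem_mem h.2.2.2 h'.2.2.2 h.2.2.1
    (by simp) (by simp) (by simp) (by simp)
  have hmem : x ∈ ({y, u, v} : Finset V) := heq ▸ (by simp)
  have hu := h.1
  have hv := h.2.1
  simp only [Finset.mem_insert, Finset.mem_singleton] at hmem
  grind

/-- An edge other than `e` through a vertex `x` of `e` consists of `x` and a link pair. -/
theorem LinearTripleSystem.exists_linkPair {E : Finset (Finset V)} (hlin : LinearTripleSystem E)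
    {e f : Finset V} (he : e ∈ E) (hf : f ∈ E) (hfe : f ≠ e) {x : V} (hx : x ∈ e) (hxf : x ∈ f) :
    ∃ u v, LinkPair E e x u v ∧ f = {x, u, v} := by
  have hcard : (f.erase x).card = 2 := by
    rw [Finset.card_erase_of_mem hxf, hlin.1 f hf]
  obtain ⟨u, v, huv, hfx⟩ := Finset.card_eq_two.mp hcard
  have hfeq : f = {x, u, v} := by rw [← Finset.insert_erase hxf, hfx]
  have hout : ∀ w ∈ f.erase x, w ∉ e := fun w hw hwe =>
    hfe (hlin.eq_of_mem_mem hf he (Finset.ne_of_mem_erase hw).symm hxf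
      (Finset.mem_of_mem_erase hw) hx hwe)
  exact ⟨u, v, ⟨hout u (by simp [hfx]), hout v (by simp [hfx]), huv, hfeq ▸ hf⟩, hfeq⟩

theorem mem_linkMatching_iff {E : Finset (Finset V)} (hlin : LinearTripleSystem E)
    {e : Finset V} (he : e ∈ E) {x : V} (hx : x ∈ e) (u : V) :
    u ∈ linkMatching E e x ↔ ∃ v, LinkPair E e x u v := by
  simp only [linkMatching, Finset.mem_biUnion, Finset.mem_filter, Finset.mem_sdiff,
    Finset.mem_singleton]
  constructor
  · rintro ⟨f, ⟨hf, hfe, hxf⟩, huf, hux⟩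
    obtain ⟨p, q, hpq, rfl⟩ := hlin.exists_linkPair he hf hfe hx hxf
    simp only [Finset.mem_insert, Finset.mem_singleton] at huf
    rcases huf with rfl | rfl | rfl
    · exact absurd rfl hux
    · exact ⟨q, hpq⟩
    · exact ⟨p, hpq.symm⟩
  · rintro ⟨v, hu, hv, huv, hE⟩
    refine ⟨_, ⟨hE, ?_, by simp⟩, by simp, ?_⟩
    · rintro rfl
      exact hu (by simp)
    · rintro rfl
      exact hu hx

/-- The link matching of a vertex of degree 4 consists of three disjoint pairs. -/
theorem exists_linkMatching_eq {E : Finset (Finset V)} (hlin : LinearTripleSystem E)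
    {e : Finset V} (he : e ∈ E) {x : V} (hx : x ∈ e) (hd : degree E x = 4) :
    ∃ p₁ p₂ p₃ p₄ p₅ p₆, LinkPair E e x p₁ p₂ ∧ LinkPair E e x p₃ p₄ ∧ LinkPair E e x p₅ p₆ ∧
      [p₁, p₂, p₃, p₄, p₅, p₆].Nodup ∧
      linkMatching E e x = {p₁, p₂, p₃, p₄, p₅, p₆} := by
  have hfilter : E.filter (fun f => f ≠ e ∧ x ∈ f) = (E.filter (fun f => x ∈ f)).erase e := by
    ext f
    simp only [Finset.mem_filter, Finset.mem_erase]
    tauto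
  have hcard : (E.filter (fun f => f ≠ e ∧ x ∈ f)).card = 3 := by
    rw [hfilter, Finset.card_erase_of_mem (by simp [he, hx])]
    unfold degree at hd
    omega
  obtain ⟨f, g, h, hfg, hfh, hgh, heq⟩ := Finset.card_eq_three.mp hcard
  have key : ∀ k ∈ ({f, g, h} : Finset (Finset V)),
      ∃ u v, LinkPair E e x u v ∧ k = {x, u, v} := by
    intro k hk
    rw [← heq, Finset.mem_filter] at hk
    exact hlin.exists_linkPair he hk.1 hk.2.1 hx hk.2.2
  obtain ⟨p₁, p₂, h₁, rfl⟩ := key f (by simp)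
  obtain ⟨p₃, p₄, h₂, rfl⟩ := key g (by simp)
  obtain ⟨p₅, p₆, h₃, rfl⟩ := key h (by simp)
  have hdisj : ∀ {u v u' v' : V}, LinkPair E e x u v → LinkPair E e x u' v' →
      ({x, u, v} : Finset V) ≠ {x, u', v'} → u ≠ u' ∧ u ≠ v' ∧ v ≠ u' ∧ v ≠ v' := by
    intro u v u' v' h h' hne
    refine ⟨?_, ?_, ?_, ?_⟩ <;> rintro rfl
    · exact hne (by rw [h.right_unique hlin hx h'])
    · exact hne (by rw [h.right_unique hlin hx h'.symm, Finset.pair_comm])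
    · exact hne (by rw [h.symm.right_unique hlin hx h', Finset.pair_comm])
    · exact hne (by rw [h.symm.right_unique hlin hx h'.symm])
  have d₁₂ := hdisj h₁ h₂ hfg
  have d₁₃ := hdisj h₁ h₃ hfh
  have d₂₃ := hdisj h₂ h₃ hgh
  have n₁ := h₁.2.2.1
  have n₂ := h₂.2.2.1
  have n₃ := h₃.2.2.1
  refine ⟨p₁, p₂, p₃, p₄, p₅, p₆, h₁, h₂, h₃, ?_, ?_⟩
  · simp only [List.nodup_cons, List.mem_cons, List.not_mem_nil, or_false, not_or]
    tauto
  · have hne : ∀ {u v}, LinkPair E e x u v → u ≠ x ∧ v ≠ x := fun h =>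
      ⟨fun h' => h.1 (h' ▸ hx), fun h' => h.2.1 (h' ▸ hx)⟩
    have m₁ := hne h₁
    have m₂ := hne h₂
    have m₃ := hne h₃
    rw [linkMatching, heq]
    ext w
    simp only [Finset.mem_biUnion, Finset.mem_insert, Finset.mem_singleton, exists_eq_or_imp,
      exists_eq_left, Finset.mem_sdiff]
    grind

/-- Without a crown on the base `{a, b, c}`, link pairs at `a`, `b` and `c` are never pairwise
disjoint. -/
theorem LinkPair.not_disjoint {E : Finset (Finset V)} (hcf : ¬ HasCrown E) {a b c : V}
    (hab : a ≠ b) (hac : a ≠ c) (hbc : b ≠ c) (he : ({a, b, c} : Finset V) ∈ E)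
    {u v w x y z : V} (ha : LinkPair E {a, b, c} a u v) (hb : LinkPair E {a, b, c} b w x)
    (hc : LinkPair E {a, b, c} c y z) :
    u = w ∨ u = x ∨ u = y ∨ u = z ∨ v = w ∨ v = x ∨ v = y ∨ v = z ∨
      w = y ∨ w = z ∨ x = y ∨ x = z := by
  by_contra! hne
  obtain ⟨hu, hv, -, hA⟩ := ha
  obtain ⟨hw, hx, -, hB⟩ := hb
  obtain ⟨hy, hz, -, hC⟩ := hc
  simp only [Finset.mem_insert, Finset.mem_singleton, not_or] at hu hv hw hx hy hz
  refine hcf ⟨_, he, _, hA, _, hB, _, hC, ?_, ?_, ?_, ⟨a, by simp⟩, ⟨b, by simp⟩, ⟨c, by simp⟩⟩ <;>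
  · simp only [Finset.disjoint_insert_left, Finset.disjoint_singleton_left, Finset.mem_insert,
      Finset.mem_singleton, not_or]
    grind

/-- Three disjoint pairs cannot each lie inside one of the two triples `{p₁, p₃, p₅}` and
`{p₂, p₄, p₆}`. -/
theorem not_three_pairs_in_two_triples {S T : Finset V} (hS : S.card ≤ 3) (hT : T.card ≤ 3)
    {r₁ r₂ r₃ r₄ r₅ r₆ : V} (hr : [r₁, r₂, r₃, r₄, r₅, r₆].Nodup)
    (h₁ : (r₁ ∈ S ∧ r₂ ∈ S) ∨ (r₁ ∈ T ∧ r₂ ∈ T))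
    (h₂ : (r₃ ∈ S ∧ r₄ ∈ S) ∨ (r₃ ∈ T ∧ r₄ ∈ T))
    (h₃ : (r₅ ∈ S ∧ r₆ ∈ S) ∨ (r₅ ∈ T ∧ r₆ ∈ T)) : False := by
  have key : ∀ {U : Finset V} {u v w x : V}, U.card ≤ 3 → [u, v, w, x].Nodup →
      u ∈ U → v ∈ U → w ∈ U → x ∈ U → False := by
    intro U u v w x hU hn hu hv hw hx
    have hle : [u, v, w, x].toFinset.card ≤ U.card := Finset.card_le_card (by
      intro t ht
      simp only [List.mem_toFinset, List.mem_cons, List.not_mem_nil, or_false] at ht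
      rcases ht with rfl | rfl | rfl | rfl <;> assumption)
    rw [List.toFinset_card_of_nodup hn] at hle
    simp only [List.length_cons, List.length_nil] at hle
    omega
  have n₁₂ : [r₁, r₂, r₃, r₄].Nodup := hr.sublist (by simp)
  have n₁₃ : [r₁, r₂, r₅, r₆].Nodup := hr.sublist (by simp)
  have n₂₃ : [r₃, r₄, r₅, r₆].Nodup := hr.sublist (by simp)
  rcases h₁ with ⟨a₁, b₁⟩ | ⟨a₁, b₁⟩ <;> rcases h₂ with ⟨a₂, b₂⟩ | ⟨a₂, b₂⟩ <;>
    rcases h₃ with ⟨a₃, b₃⟩ | ⟨a₃, b₃⟩ <;>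
  first
  | exact key hS n₁₂ a₁ b₁ a₂ b₂
  | exact key hT n₁₂ a₁ b₁ a₂ b₂
  | exact key hS n₁₃ a₁ b₁ a₃ b₃
  | exact key hT n₁₃ a₁ b₁ a₃ b₃
  | exact key hS n₂₃ a₂ b₂ a₃ b₃
  | exact key hT n₂₃ a₂ b₂ a₃ b₃

/-- The link pairs at `a` and `b` do not form an alternating hexagon `p₁ ⋯ p₆`. -/
theorem not_hexagon {E : Finset (Finset V)} (hlin : LinearTripleSystem E) (hcf : ¬ HasCrown E)
    {a b c : V} (hab : a ≠ b) (hac : a ≠ c) (hbc : b ≠ c) (he : ({a, b, c} : Finset V) ∈ E)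
    (hdc : degree E c = 4) {p₁ p₂ p₃ p₄ p₅ p₆ : V} (hp : [p₁, p₂, p₃, p₄, p₅, p₆].Nodup)
    (h₁₂ : LinkPair E {a, b, c} a p₁ p₂) (h₃₄ : LinkPair E {a, b, c} a p₃ p₄)
    (h₅₆ : LinkPair E {a, b, c} a p₅ p₆) (h₂₃ : LinkPair E {a, b, c} b p₂ p₃)
    (h₄₅ : LinkPair E {a, b, c} b p₄ p₅) (h₆₁ : LinkPair E {a, b, c} b p₆ p₁) : False := by
  obtain ⟨r₁, r₂, r₃, r₄, r₅, r₆, k₁, k₂, k₃, hr, -⟩ :=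
    exists_linkMatching_eq hlin he (x := c) (by simp) hdc
  have key : ∀ {y z}, LinkPair E {a, b, c} c y z →
      (y ∈ ({p₁, p₃, p₅} : Finset V) ∧ z ∈ ({p₁, p₃, p₅} : Finset V)) ∨
      (y ∈ ({p₂, p₄, p₆} : Finset V) ∧ z ∈ ({p₂, p₄, p₆} : Finset V)) := by
    intro y z h
    have c₁ := LinkPair.not_disjoint hcf hab hac hbc he h₁₂ h₄₅ h
    have c₂ := LinkPair.not_disjoint hcf hab hac hbc he h₃₄ h₆₁ h
    have c₃ := LinkPair.not_disjoint hcf hab hac hbc he h₅₆ h₂₃ h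
    have ea : ∀ {u v}, LinkPair E {a, b, c} a u v → ¬ (y = u ∧ z = v) ∧ ¬ (y = v ∧ z = u) := by
      intro u v huv
      constructor <;> rintro ⟨rfl, rfl⟩
      · exact hac (huv.base_unique hlin (by simp) h)
      · exact hac (huv.base_unique hlin (by simp) h.symm)
    have eb : ∀ {u v}, LinkPair E {a, b, c} b u v → ¬ (y = u ∧ z = v) ∧ ¬ (y = v ∧ z = u) := by
      intro u v huv
      constructor <;> rintro ⟨rfl, rfl⟩
      · exact hbc (huv.base_unique hlin (by simp) h)
      · exact hbc (huv.base_unique hlin (by simp) h.symm)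
    have e₁ := ea h₁₂
    have e₂ := ea h₃₄
    have e₃ := ea h₅₆
    have e₄ := eb h₂₃
    have e₅ := eb h₄₅
    have e₆ := eb h₆₁
    simp only [List.nodup_cons, List.mem_cons, List.not_mem_nil, or_false, not_or] at hp
    simp only [Finset.mem_insert, Finset.mem_singleton]
    clear h₁₂ h₃₄ h₅₆ h₂₃ h₄₅ h₆₁ k₁ k₂ k₃ hr ea eb h
    grind
  exact not_three_pairs_in_two_triples Finset.card_le_three Finset.card_le_three hr
    (key k₁) (key k₂) (key k₃)

/-- If `M_a = {p₁, …, p₆}` is matched within itself by the pairs at `b`, then no pair at `b` joins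
two of the pairs at `a`. -/
theorem not_linkPair_of_matched {E : Finset (Finset V)} (hlin : LinearTripleSystem E)
    (hcf : ¬ HasCrown E) {a b c : V} (hab : a ≠ b) (hac : a ≠ c) (hbc : b ≠ c)
    (he : ({a, b, c} : Finset V) ∈ E) (hdc : degree E c = 4) {p₁ p₂ p₃ p₄ p₅ p₆ : V}
    (hp : [p₁, p₂, p₃, p₄, p₅, p₆].Nodup)
    (h₁₂ : LinkPair E {a, b, c} a p₁ p₂) (h₃₄ : LinkPair E {a, b, c} a p₃ p₄)
    (h₅₆ : LinkPair E {a, b, c} a p₅ p₆)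
    (hM : ∀ u ∈ [p₁, p₂, p₃, p₄, p₅, p₆], ∃ v ∈ [p₁, p₂, p₃, p₄, p₅, p₆],
      LinkPair E {a, b, c} b u v) : ¬ LinkPair E {a, b, c} b p₂ p₃ := by
  intro h₂₃
  have hex : ∀ {u v}, LinkPair E {a, b, c} a u v → ¬ LinkPair E {a, b, c} b u v :=
    fun h h' => hab (h.base_unique hlin (by simp) h')
  have huniq : ∀ {u v w}, LinkPair E {a, b, c} b v u → LinkPair E {a, b, c} b w u → v = w :=
    fun h h' => h.symm.right_unique hlin (by simp) h'.symm
  have hp' := hp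
  simp only [List.nodup_cons, List.mem_cons, List.not_mem_nil, or_false, not_or] at hp'
  obtain ⟨v, hv, h₄⟩ := hM p₄ (by simp)
  obtain ⟨w, hw, h₅⟩ := hM p₅ (by simp)
  obtain ⟨x, hx, h₆⟩ := hM p₆ (by simp)
  simp only [List.mem_cons, List.not_mem_nil, or_false] at hv hw hx
  have n₄ := h₄.2.2.1
  have n₅ := h₅.2.2.1
  have n₆ := h₆.2.2.1
  have hv' : v = p₁ ∨ v = p₅ ∨ v = p₆ := by
    rcases hv with rfl | rfl | rfl | rfl | rfl | rfl
    · simp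
    · have := huniq h₂₃.symm h₄; grind
    · exact absurd h₄ (hex h₃₄.symm)
    · exact absurd rfl n₄
    · simp
    · simp
  have hw' : w = p₁ ∨ w = p₄ := by
    rcases hw with rfl | rfl | rfl | rfl | rfl | rfl
    · simp
    · have := huniq h₂₃.symm h₅; grind
    · have := huniq h₂₃ h₅; grind
    · simp
    · exact absurd rfl n₅
    · exact absurd h₅ (hex h₅₆)
  have hx' : x = p₁ ∨ x = p₄ := by
    rcases hx with rfl | rfl | rfl | rfl | rfl | rfl
    · simp
    · have := huniq h₂₃.symm h₆; grind
    · have := huniq h₂₃ h₆; grind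
    · simp
    · exact absurd h₆ (hex h₅₆.symm)
    · exact absurd rfl n₆
  rcases hw' with rfl | rfl <;> rcases hx' with rfl | rfl
  · have := huniq h₅ h₆; grind
  · exact not_hexagon hlin hcf hab hac hbc he hdc
      (by simp only [List.nodup_cons, List.mem_cons, List.not_mem_nil, or_false, not_or]; grind)
      h₁₂ h₃₄ h₅₆.symm h₂₃ h₆.symm h₅
  · exact not_hexagon hlin hcf hab hac hbc he hdc hp h₁₂ h₃₄ h₅₆ h₂₃ h₅.symm h₆
  · have := huniq h₅ h₆; grind

end

/-- In a crown-free linear 3-graph with an edge `e = {a,b,c}` all of whose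
vertices have degree 4, we have `|M_a ∩ M_b| ≤ 5`. -/
theorem linkMatchings_inter_le_five {V : Type*} [DecidableEq V] (E : Finset (Finset V))
    (hlin : LinearTripleSystem E) (hcf : ¬ HasCrown E)
    (a b c : V) (hab : a ≠ b) (hac : a ≠ c) (hbc : b ≠ c)
    (he : ({a, b, c} : Finset V) ∈ E)
    (hda : degree E a = 4) (hdb : degree E b = 4) (hdc : degree E c = 4) :
    ((linkMatching E {a, b, c} a) ∩ (linkMatching E {a, b, c} b)).card ≤ 5 := by
  by_contra! hlt
  obtain ⟨p₁, p₂, p₃, p₄, p₅, p₆, h₁₂, h₃₄, h₅₆, hp, hMa⟩ :=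
    exists_linkMatching_eq hlin he (x := a) (by simp) hda
  obtain ⟨q₁, q₂, q₃, q₄, q₅, q₆, -, -, -, -, hMb⟩ :=
    exists_linkMatching_eq hlin he (x := b) (by simp) hdb
  have ha : (linkMatching E {a, b, c} a).card ≤ 6 := hMa ▸ Finset.card_le_six
  have hb : (linkMatching E {a, b, c} b).card ≤ 6 := hMb ▸ Finset.card_le_six
  have heq : linkMatching E {a, b, c} a = linkMatching E {a, b, c} b :=
    (Finset.eq_of_subset_of_card_le Finset.inter_subset_left (by omega)).symm.trans
      (Finset.eq_of_subset_of_card_le Finset.inter_subset_right (by omega))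
  have hmem : ∀ u, u ∈ [p₁, p₂, p₃, p₄, p₅, p₆] ↔ ∃ v, LinkPair E {a, b, c} b u v := by
    intro u
    rw [← mem_linkMatching_iff hlin he (by simp), ← heq, hMa]
    simp
  have hM : ∀ u ∈ [p₁, p₂, p₃, p₄, p₅, p₆], ∃ v ∈ [p₁, p₂, p₃, p₄, p₅, p₆],
      LinkPair E {a, b, c} b u v := by
    intro u hu
    obtain ⟨v, hv⟩ := (hmem u).mp hu
    exact ⟨v, (hmem v).mpr ⟨u, hv.symm⟩, hv⟩
  obtain ⟨v, hv, h₂⟩ := hM p₂ (by simp)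
  simp only [List.mem_cons, List.not_mem_nil, or_false] at hv
  rcases hv with rfl | rfl | rfl | rfl | rfl | rfl
  · exact hab (h₁₂.symm.base_unique hlin (by simp) h₂)
  · exact h₂.2.2.1 rfl
  · exact not_linkPair_of_matched hlin hcf hab hac hbc he hdc hp
      h₁₂ h₃₄ h₅₆ hM h₂
  · exact not_linkPair_of_matched hlin hcf hab hac hbc he hdc
      (by simp only [List.nodup_cons, List.mem_cons, List.not_mem_nil, or_false, not_or] at hp ⊢; grind)
      h₁₂ h₃₄.symm h₅₆ (by simpa [or_comm, or_left_comm] using hM) h₂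
  · exact not_linkPair_of_matched hlin hcf hab hac hbc he hdc
      (by simp only [List.nodup_cons, List.mem_cons, List.not_mem_nil, or_false, not_or] at hp ⊢; grind)
      h₁₂ h₅₆ h₃₄ (by simpa [or_comm, or_left_comm] using hM) h₂
  · exact not_linkPair_of_matched hlin hcf hab hac hbc he hdc
      (by simp only [List.nodup_cons, List.mem_cons, List.not_mem_nil, or_false, not_or] at hp ⊢; grind)
      h₁₂ h₅₆.symm h₃₄ (by simpa [or_comm, or_left_comm] using hM) h₂
end
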